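/- arXiv:1803.01385 — 5 statements merged into one kernel-verified Lean document; each statement's English description precedes it below -/
import Mathlib

section
/- Let (G,I) be a 3-transposition group and α, β nonzero complex numbers with α ∉ {0, 2}. For i ∈ I, the adjoint map ad(x^i) : v ↦ x^i · v on B_{α,β}(G) is diagonalizable with all eigenvalues contained in {2, 0, α}, the eigenspace for the eigenvalue 2 is exactly the line ℂx^i, and B_{α,β}(G) = ℂx^i ⊕ ker(ad(x^i)) ⊕ ker(ad(x^i) − α). -/
/-- A 3-transposition group: a group `G` together with a set `I` of involutions generating
`G`, closed under conjugation, such that the product of any two elements of `I` has order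
at most 3. -/
structure IsThreeTransposition {G : Type*} [Group G] (I : Set G) : Prop where
  gen : Subgroup.closure I = ⊤
  ne_one : ∀ a ∈ I, a ≠ 1
  sq : ∀ a ∈ I, a * a = 1
  conj_mem : ∀ a ∈ I, ∀ b ∈ I, a * b * a ∈ I
  ord : ∀ a ∈ I, ∀ b ∈ I, orderOf (a * b) ≤ 3

open scoped Classical

variable {G : Type*} [Group G] {I : Set G}

/-- The basis vector `x^i` of the Matsuo algebra. -/
noncomputable def xi (i : I) : I →₀ ℂ := Finsupp.single i 1

/-- The product of two basis vectors of the Matsuo algebra `B_{α,β}(G)`. -/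
noncomputable def matsuoMulBasis (h : IsThreeTransposition I) (α : ℂ) (i j : I) :
    I →₀ ℂ :=
  if i = j then (2 : ℂ) • xi i
  else if (i : G) * j = (j : G) * i then 0
  else (α / 2) • (xi i + xi j - xi ⟨(i : G) * j * i, h.conj_mem i i.2 j j.2⟩)

/-- The (bilinear) product of the Matsuo algebra `B_{α,β}(G)`. -/
noncomputable def matsuoMul (h : IsThreeTransposition I) (α : ℂ) (v w : I →₀ ℂ) :
    I →₀ ℂ :=
  v.sum fun i c => w.sum fun j d => (c * d) • matsuoMulBasis h α i j

/-- The bilinear form of the Matsuo algebra on basis vectors. -/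
noncomputable def matsuoFormBasis (α β : ℂ) (i j : I) : ℂ :=
  if i = j then β / 2
  else if (i : G) * j = (j : G) * i then 0
  else α * β / 8

/-- The (bilinear) form of the Matsuo algebra `B_{α,β}(G)`. -/
noncomputable def matsuoForm (α β : ℂ) (v w : I →₀ ℂ) : ℂ :=
  v.sum fun i c => w.sum fun j d => c * d * matsuoFormBasis α β i j

/-- The adjoint map `ad(x^i)` of the Matsuo algebra as a linear map. -/
noncomputable def matsuoAd (h : IsThreeTransposition I) (α : ℂ) (i : I) :
    (I →₀ ℂ) →ₗ[ℂ] (I →₀ ℂ) :=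
  Finsupp.linearCombination ℂ (matsuoMulBasis h α i)

theorem matsuoMul_xi (h : IsThreeTransposition I) (α : ℂ) (i : I) (v : I →₀ ℂ) :
    matsuoMul h α (xi i) v = matsuoAd h α i v := by
  simp [matsuoMul, matsuoAd, xi, Finsupp.linearCombination_apply]

theorem matsuoAd_xi (h : IsThreeTransposition I) (α : ℂ) (i j : I) :
    matsuoAd h α i (xi j) = matsuoMulBasis h α i j := by
  simp [matsuoAd, xi]

theorem matsuoAd_xi_self (h : IsThreeTransposition I) (α : ℂ) (i : I) :
    matsuoAd h α i (xi i) = (2 : ℂ) • xi i := by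
  rw [matsuoAd_xi, matsuoMulBasis, if_pos rfl]

/-- On a basis vector not commuting with `x^i`, the difference `x^j - x^{i∘j}` is an
`α`-eigenvector of `ad(x^i)`. -/
theorem matsuoAd_xi_sub_conj (h : IsThreeTransposition I) (α : ℂ) (i j : I)
    (hc : ¬ (i : G) * j = (j : G) * i) :
    matsuoAd h α i (xi j - xi ⟨(i : G) * j * i, h.conj_mem i i.2 j j.2⟩) =
      α • (xi j - xi ⟨(i : G) * j * i, h.conj_mem i i.2 j j.2⟩) := by
  have hi : (i : G) * i = 1 := h.sq i i.2
  have hne : ¬ i = j := by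
    rintro rfl
    exact hc rfl
  have hl : (i : G) * (i * j * i) = j * i := by
    rw [mul_assoc, ← mul_assoc, hi, one_mul]
  have hr : (i : G) * j * i * i = i * j := by
    rw [mul_assoc, hi, mul_one]
  have hc' : ¬ (i : G) * (i * j * i) = (i : G) * j * i * i := by
    rw [hl, hr]
    exact fun e => hc e.symm
  have hne' : ¬ i = ⟨(i : G) * j * i, h.conj_mem i i.2 j j.2⟩ := by
    intro e
    have e' : (i : G) = (i : G) * j * i := congrArg Subtype.val e
    rw [← e'] at hc'
    exact hc' rfl
  have hconj : (⟨(i : G) * (i * j * i) * i, h.conj_mem i i.2 _ (h.conj_mem i i.2 j j.2)⟩ : I)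
      = j := by
    apply Subtype.ext
    change (i : G) * (i * j * i) * i = j
    rw [hl, mul_assoc, hi, mul_one]
  rw [map_sub, matsuoAd_xi, matsuoAd_xi, matsuoMulBasis, matsuoMulBasis, if_neg hne, if_neg hc,
    if_neg hne', if_neg hc', hconj]
  module

/-- The map `ad(x^i) (ad(x^i) - α)` takes values in the line `ℂ x^i`. -/
theorem exists_matsuoAd_sq_sub_eq_smul (h : IsThreeTransposition I) (α : ℂ) (i : I)
    (v : I →₀ ℂ) :
    ∃ c : ℂ, matsuoAd h α i (matsuoAd h α i v) - α • matsuoAd h α i v = c • xi i := by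
  induction v using Finsupp.induction_linear with
  | zero => exact ⟨0, by simp⟩
  | add v w hv hw =>
    obtain ⟨c, hc⟩ := hv
    obtain ⟨d, hd⟩ := hw
    refine ⟨c + d, ?_⟩
    rw [add_smul, ← hc, ← hd]
    simp only [map_add]
    module
  | single j a =>
    have hs : Finsupp.single j a = a • xi j := by simp [xi]
    suffices hj : ∃ c : ℂ, matsuoAd h α i (matsuoAd h α i (xi j)) -
        α • matsuoAd h α i (xi j) = c • xi i by
      obtain ⟨c, hc⟩ := hj
      refine ⟨a * c, ?_⟩
      rw [hs, mul_smul, ← hc]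
      simp only [map_smul]
      module
    by_cases hij : i = j
    · subst hij
      refine ⟨4 - 2 * α, ?_⟩
      simp only [matsuoAd_xi_self, map_smul]
      module
    · by_cases hcomm : (i : G) * j = (j : G) * i
      · refine ⟨0, ?_⟩
        rw [matsuoAd_xi h α i j, matsuoMulBasis, if_neg hij, if_pos hcomm]
        simp
      · refine ⟨α / 2 * (2 - α), ?_⟩
        rw [matsuoAd_xi h α i j, matsuoMulBasis, if_neg hij, if_neg hcomm, add_sub_assoc,
          map_smul, map_add, matsuoAd_xi_self, matsuoAd_xi_sub_conj h α i j hcomm]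
        module

/-- For `α ∉ {0,2}` and `i ∈ I`, the adjoint map `ad(x^i)` on `B_{α,β}(G)` is
diagonalizable with eigenvalues in `{2, 0, α}`: its `2`-eigenspace is exactly `ℂ x^i`,
and every element decomposes uniquely as a sum of a multiple of `x^i`, a `0`-eigenvector
and an `α`-eigenvector. -/
theorem stmt8 {G : Type*} [Group G] {I : Set G} (h : IsThreeTransposition I)
    (α β : ℂ) (hα : α ≠ 0) (hβ : β ≠ 0) (hα2 : α ≠ 2) (i : I) :
    (∀ v : I →₀ ℂ, matsuoMul h α (xi i) v = (2 : ℂ) • v ↔ ∃ c : ℂ, v = c • xi i) ∧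
    (∀ v : I →₀ ℂ, ∃! t : ℂ × (I →₀ ℂ) × (I →₀ ℂ),
      matsuoMul h α (xi i) t.2.1 = 0 ∧
      matsuoMul h α (xi i) t.2.2 = α • t.2.2 ∧
      v = t.1 • xi i + t.2.1 + t.2.2) := by
  have hα2' : (2 : ℂ) - α ≠ 0 := sub_ne_zero.mpr (Ne.symm hα2)
  have hx : xi i ≠ 0 := by simp [xi]
  have hAx := matsuoAd_xi_self h α i
  simp only [matsuoMul_xi]
  generalize hA : matsuoAd h α i = A at hAx ⊢
  have hline : ∀ v, ∃ c : ℂ, A (A v) - α • A v = c • xi i := by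
    subst hA
    exact exists_matsuoAd_sq_sub_eq_smul h α i
  refine ⟨fun v => ⟨fun hv => ?_, ?_⟩, fun v => ?_⟩
  · obtain ⟨c, hc⟩ := hline v
    rw [hv, map_smul, hv] at hc
    refine ⟨(2 * (2 - α))⁻¹ * c, ?_⟩
    rw [mul_smul, ← hc, eq_inv_smul_iff₀ (mul_ne_zero two_ne_zero hα2')]
    module
  · rintro ⟨c, rfl⟩
    rw [map_smul, hAx, smul_comm]
  · obtain ⟨c, hc⟩ := hline v
    obtain ⟨t, rfl⟩ : ∃ t, c = 2 * (2 - α) * t :=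
      ⟨c / (2 * (2 - α)), by field_simp⟩
    have hAA : A (A v) = α • A v + (2 * (2 - α) * t) • xi i := by
      rw [← hc]
      abel
    refine ⟨(t, v - t • xi i - α⁻¹ • (A v - (2 * t) • xi i), α⁻¹ • (A v - (2 * t) • xi i)),
      ⟨?_, ?_, ?_⟩, ?_⟩
    · simp only [map_sub, map_smul, hAx, hAA]
      match_scalars <;> field_simp <;> ring
    · simp only [map_sub, map_smul, hAx, hAA]
      match_scalars <;> field_simp <;> ring
    · simp only
      abel
    · rintro ⟨s, a, b⟩ ⟨ha, hb, hv⟩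
      simp only at ha hb hv
      have hAv : A v = (2 * s) • xi i + α • b := by
        rw [hv, map_add, map_add, map_smul, hAx, ha, hb]
        module
      have hst : s = t := by
        have hs : (2 * (2 - α) * s) • xi i = (2 * (2 - α) * t) • xi i := by
          rw [← hc, hAv, map_add, map_smul, map_smul, hAx, hb]
          module
        exact mul_left_cancel₀ (mul_ne_zero two_ne_zero hα2') (smul_left_injective ℂ hx hs)
      subst hst
      have hb' : b = α⁻¹ • (A v - (2 * s) • xi i) := by
        rw [hAv, add_sub_cancel_left, inv_smul_smul₀ hα]
      rw [← hb', hv]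
      simp only [Prod.mk.injEq, true_and, and_true]
      abel
end

section
/- Let (G,I) be a 3-transposition group and α, β nonzero complex numbers with α ∉ {0, 2}. For i ∈ I, let ρ_i be the linear map on B_{α,β}(G) with ρ_i(x^j) = x^{i∘j} if i ∼ j and ρ_i(x^j) = x^j otherwise, and set B[i;h] = ker(ad(x^i) − h). Then the fixed space of ρ_i equals ℂx^i ⊕ B[i;0] and the (−1)-eigenspace of ρ_i equals B[i;α]; that is, ρ_i(v) = v for v ∈ ℂx^i ⊕ B[i;0] and ρ_i(v) = −v for v ∈ B[i;α]. -/
open scoped Classical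

variable {G : Type*} [Group G] {I : Set G}

/-- The value of the Miyamoto-type involution `ρ_i` on a basis vector:
`ρ_i(x^j) = x^{i∘j}` if `i ∼ j` and `ρ_i(x^j) = x^j` otherwise. -/
noncomputable def rhoBasis (h : IsThreeTransposition I) (i j : I) : I →₀ ℂ :=
  if (i : G) * j = (j : G) * i then xi j
  else xi ⟨(i : G) * j * i, h.conj_mem i i.2 j j.2⟩

/-- The linear map `ρ_i` on `B_{α,β}(G)`. -/
noncomputable def rho (h : IsThreeTransposition I) (i : I) (v : I →₀ ℂ) : I →₀ ℂ :=
  v.sum fun j d => d • rhoBasis h i j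

/-- `ρ_i` as a bundled linear map. -/
noncomputable def rhoLin (h : IsThreeTransposition I) (i : I) : (I →₀ ℂ) →ₗ[ℂ] (I →₀ ℂ) :=
  Finsupp.linearCombination ℂ (rhoBasis h i)

/-- Multiplication by `x^i` as a bundled linear map. -/
noncomputable def adLin (h : IsThreeTransposition I) (α : ℂ) (i : I) :
    (I →₀ ℂ) →ₗ[ℂ] (I →₀ ℂ) :=
  Finsupp.linearCombination ℂ (matsuoMulBasis h α i)

/-- The linear functional measuring the component of `ad(x^i)` along `x^i` that is not
accounted for by `(α / 2) (1 - ρ_i)`. -/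
noncomputable def axisCoeff (α : ℂ) (i : I) : (I →₀ ℂ) →ₗ[ℂ] ℂ :=
  Finsupp.linearCombination ℂ fun j : I =>
    if i = j then 2 else if (i : G) * j = (j : G) * i then 0 else α / 2

theorem rho_eq_rhoLin (h : IsThreeTransposition I) (i : I) (v : I →₀ ℂ) :
    rho h i v = rhoLin h i v := rfl

theorem matsuoMul_xi_eq_adLin (h : IsThreeTransposition I) (α : ℂ) (i : I) (v : I →₀ ℂ) :
    matsuoMul h α (xi i) v = adLin h α i v := by
  simp [matsuoMul, xi, adLin, Finsupp.linearCombination_apply, Finsupp.sum_single_index]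

theorem rhoLin_xi (h : IsThreeTransposition I) (i j : I) :
    rhoLin h i (xi j) = rhoBasis h i j := by
  simp [rhoLin, xi]

theorem adLin_xi (h : IsThreeTransposition I) (α : ℂ) (i j : I) :
    adLin h α i (xi j) = matsuoMulBasis h α i j := by
  simp [adLin, xi]

theorem axisCoeff_xi (α : ℂ) (i j : I) :
    axisCoeff α i (xi j) =
      if i = j then 2 else if (i : G) * j = (j : G) * i then 0 else α / 2 := by
  simp [axisCoeff, xi]

theorem linearMap_ext_xi {X M : Type*} {S : Set X} [AddCommMonoid M] [Module ℂ M]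
    {f g : (S →₀ ℂ) →ₗ[ℂ] M} (hfg : ∀ j, f (xi j) = g (xi j)) : f = g :=
  Finsupp.lhom_ext' fun j => LinearMap.ext_ring (hfg j)

theorem rhoLin_xi_self (h : IsThreeTransposition I) (i : I) :
    rhoLin h i (xi i) = xi i := by
  simp [rhoLin_xi, rhoBasis]

theorem adLin_xi_self (h : IsThreeTransposition I) (α : ℂ) (i : I) :
    adLin h α i (xi i) = (2 : ℂ) • xi i := by
  simp [adLin_xi, matsuoMulBasis]

/-- Conjugation by an involution preserves non-commutation with it. -/
theorem commute_conj_iff {a b : G} (ha : a * a = 1) :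
    a * (a * b * a) = a * b * a * a ↔ a * b = b * a := by
  have h₁ : a * (a * b * a) = b * a := by rw [← mul_assoc, ← mul_assoc, ha, one_mul]
  have h₂ : a * b * a * a = a * b := by rw [mul_assoc, ha, mul_one]
  rw [h₁, h₂, eq_comm]

theorem adLin_apply (h : IsThreeTransposition I) (α : ℂ) (i : I) (v : I →₀ ℂ) :
    adLin h α i v = (α / 2) • (v - rhoLin h i v) + axisCoeff α i v • xi i := by
  have key : adLin h α i =
      (α / 2) • (LinearMap.id - rhoLin h i) + (axisCoeff α i).smulRight (xi i) := by
    refine linearMap_ext_xi fun j => ?_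
    simp only [LinearMap.add_apply, LinearMap.smul_apply, LinearMap.sub_apply,
      LinearMap.id_apply, LinearMap.smulRight_apply, adLin_xi, rhoLin_xi, axisCoeff_xi,
      matsuoMulBasis, rhoBasis]
    by_cases hij : i = j
    · subst hij
      simp
    · by_cases hc : (i : G) * j = (j : G) * i
      · simp [hij, hc]
      · simp only [hij, hc, if_false]
        module
  rw [key]
  rfl

theorem axisCoeff_rhoLin (h : IsThreeTransposition I) (α : ℂ) (i : I) (v : I →₀ ℂ) :
    axisCoeff α i (rhoLin h i v) = axisCoeff α i v := by
  have key : axisCoeff α i ∘ₗ rhoLin h i = axisCoeff α i := by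
    refine linearMap_ext_xi fun j => ?_
    rw [LinearMap.comp_apply, rhoLin_xi, rhoBasis]
    split_ifs with hc
    · rfl
    · have hc' := mt (commute_conj_iff (h.sq i i.2)).1 hc
      have hij : i ≠ j := fun e => hc (by rw [e])
      have hij' : i ≠ ⟨(i : G) * j * i, h.conj_mem i i.2 j j.2⟩ := fun e =>
        by
        have e' : (i : G) * j * i = i := (congrArg Subtype.val e).symm
        exact hc' (by rw [e'])
      rw [axisCoeff_xi, axisCoeff_xi, if_neg hij, if_neg hij', if_neg hc, if_neg hc']
  exact LinearMap.congr_fun key v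

theorem rhoLin_apply_self (h : IsThreeTransposition I) (i : I) (v : I →₀ ℂ) :
    rhoLin h i v i = v i := by
  have key : Finsupp.lapply (R := ℂ) i ∘ₗ rhoLin h i = Finsupp.lapply (R := ℂ) i := by
    refine linearMap_ext_xi fun j => ?_
    rw [LinearMap.comp_apply, rhoLin_xi, rhoBasis]
    split_ifs with hc
    · rfl
    · have hc' := mt (commute_conj_iff (h.sq i i.2)).1 hc
      have hij : j ≠ i := fun e => hc (by rw [e])
      have hij' : (⟨(i : G) * j * i, h.conj_mem i i.2 j j.2⟩ : I) ≠ i := fun e =>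
        by
        have e' : (i : G) * j * i = i := congrArg Subtype.val e
        exact hc' (by rw [e'])
      rw [Finsupp.lapply_apply, Finsupp.lapply_apply, xi, xi,
        Finsupp.single_eq_of_ne' hij, Finsupp.single_eq_of_ne' hij']
  exact LinearMap.congr_fun key v

/-- For `α ∉ {0,2}` and `i ∈ I`, the fixed space of `ρ_i` equals
`ℂ x^i ⊕ B[i;0]` and the `(−1)`-eigenspace of `ρ_i` equals `B[i;α]`, where
`B[i;h] = ker(ad(x^i) − h)`. -/
theorem stmt9 {G : Type*} [Group G] {I : Set G} (h : IsThreeTransposition I)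
    (α β : ℂ) (hα : α ≠ 0) (hβ : β ≠ 0) (hα2 : α ≠ 2) (i : I) :
    (∀ v : I →₀ ℂ, rho h i v = v ↔
      ∃ (c : ℂ) (w : I →₀ ℂ), matsuoMul h α (xi i) w = 0 ∧ v = c • xi i + w) ∧
    (∀ v : I →₀ ℂ, rho h i v = -v ↔ matsuoMul h α (xi i) v = α • v) := by
  simp only [rho_eq_rhoLin, matsuoMul_xi_eq_adLin]
  refine ⟨fun v => ⟨fun hv => ?_, ?_⟩, fun v => ⟨fun hv => ?_, fun hv => ?_⟩⟩
  · refine ⟨axisCoeff α i v / 2, v - (axisCoeff α i v / 2) • xi i, ?_, by module⟩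
    rw [map_sub, map_smul, adLin_xi_self, adLin_apply, hv]
    module
  · rintro ⟨c, w, hw, rfl⟩
    rw [adLin_apply] at hw
    have hcoeff : axisCoeff α i w = 0 := by
      simpa [xi, rhoLin_apply_self] using DFunLike.congr_fun hw i
    rw [hcoeff, zero_smul, add_zero, smul_eq_zero, sub_eq_zero] at hw
    have hρ : w = rhoLin h i w := hw.resolve_left (div_ne_zero hα two_ne_zero)
    rw [map_add, map_smul, rhoLin_xi_self, ← hρ]
  · have hcoeff : axisCoeff α i v = 0 := by
      have := axisCoeff_rhoLin h α i v
      rw [hv, map_neg] at this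
      exact self_eq_neg.1 this.symm
    rw [adLin_apply, hv, hcoeff]
    module
  · rw [adLin_apply] at hv
    have hsum : axisCoeff α i v • xi i = (α / 2) • (v + rhoLin h i v) := by
      rw [eq_sub_of_add_eq' hv]
      module
    have hcoeff : axisCoeff α i v = 0 := by
      have := congrArg (axisCoeff α i) hsum
      rw [map_smul, map_smul, map_add, axisCoeff_rhoLin, axisCoeff_xi, if_pos rfl,
        smul_eq_mul, smul_eq_mul] at this
      have h₀ : (2 - α) * axisCoeff α i v = 0 := by linear_combination this
      exact (mul_eq_zero.1 h₀).resolve_left (sub_ne_zero.2 hα2.symm)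
    rw [hcoeff, zero_smul, eq_comm, smul_eq_zero] at hsum
    exact eq_neg_of_add_eq_zero_right (hsum.resolve_left (div_ne_zero hα two_ne_zero))
end

section
/- Let (G,I) be a 3-transposition group with I finite and forming a single conjugacy class of G, let α, β be nonzero complex numbers, and let k be the common number of j ∈ I with j ∼ i. Then for every j ∈ I, (Σ_{i∈I} x^i) · x^j = (kα/2 + 2) x^j in B_{α,β}(G); consequently, if kα + 4 ≠ 0, the element ω := (4/(kα+4)) Σ_{i∈I} x^i satisfies ω · v = 2v for every v ∈ B_{α,β}(G). -/
open scoped Classical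

variable {G : Type*} [Group G] {I : Set G}

/-- If the product of two involutions has order at most 3 and the involutions do not commute,
then the two involutions satisfy the braid relation; finiteness of the conjugation-closed set
excludes products of infinite order. -/
theorem IsThreeTransposition.braid {G : Type*} [Group G] {I : Set G}
    (h : IsThreeTransposition I) (hI : I.Finite) {a b : G} (ha : a ∈ I) (hb : b ∈ I)
    (hab : a * b ≠ b * a) : a * b * a = b * a * b := by
  have haa := h.sq a ha
  have hbb := h.sq b hb
  have hai : a⁻¹ = a := inv_eq_of_mul_eq_one_left haa
  have hbi : b⁻¹ = b := inv_eq_of_mul_eq_one_left hbb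
  have hinv : (a * b)⁻¹ = b * a := by rw [mul_inv_rev, hai, hbi]
  have hmem : ∀ n : ℕ, (a * b) ^ (2 * n) * a ∈ I := by
    intro n
    induction n with
    | zero => simpa using ha
    | succ n ih =>
      have h1 := h.conj_mem a ha _ (h.conj_mem b hb _ ih)
      have hconj : ∀ m : ℕ, (a * b) ^ m * a * (b * a) = (a * b) ^ (m + 1) * a := by
        intro m
        rw [pow_succ]
        group
      convert h1 using 1
      calc (a * b) ^ (2 * (n + 1)) * a = (a * b) * (a * b) ^ (2 * n) * a * (b * a) := by
            rw [mul_assoc (a * b), mul_assoc (a * b), hconj,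
              show 2 * (n + 1) = 2 * n + 1 + 1 by ring,
              pow_succ' (a * b) (2 * n + 1), mul_assoc]
        _ = a * (b * ((a * b) ^ (2 * n) * a) * b) * a := by simp only [mul_assoc]
  have hfin : IsOfFinOrder (a * b) := by
    have : Finite I := hI
    obtain ⟨m, n, hmn, hEq⟩ := Finite.exists_ne_map_eq_of_infinite
      (fun n : ℕ => (⟨_, hmem n⟩ : I))
    have h2 : (a * b) ^ (2 * m) = (a * b) ^ (2 * n) := by
      simpa using hEq
    by_contra hcon
    have := injective_pow_iff_not_isOfFinOrder.mpr hcon h2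
    omega
  have hpos := hfin.orderOf_pos
  have hle := h.ord a ha b hb
  have hpow := pow_orderOf_eq_one (a * b)
  have hcases : orderOf (a * b) = 1 ∨ orderOf (a * b) = 2 ∨ orderOf (a * b) = 3 := by omega
  rcases hcases with h1 | h1 | h1 <;> rw [h1] at hpow
  · rw [pow_one] at hpow
    exact absurd (by rw [← hinv, hpow, inv_one]) hab
  · rw [pow_two] at hpow
    exact absurd (by rw [← hinv]; exact eq_inv_of_mul_eq_one_left hpow) hab
  · have h3 : (a * b * a) * (b * a * b) = 1 := by
      rw [← hpow, pow_three]
      group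
    rw [eq_inv_of_mul_eq_one_left h3, mul_inv_rev, mul_inv_rev, hai, hbi, mul_assoc]

/-- Conjugation by `j ∈ I` as an involutive permutation of `I`. -/
def IsThreeTransposition.conjPerm {G : Type*} [Group G] {I : Set G}
    (h : IsThreeTransposition I) (j : I) : Equiv.Perm I :=
  Function.Involutive.toPerm
    (fun i => ⟨(j : G) * i * j, h.conj_mem j j.2 i i.2⟩) fun i => Subtype.ext <| by
      have hj := h.sq j j.2
      calc (j : G) * (j * i * j) * j = (j * j) * i * (j * j) := by simp only [mul_assoc]
        _ = i := by rw [hj, one_mul, mul_one]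

/-- Conjugation by `j` preserves the elements not commuting with `j`. -/
theorem IsThreeTransposition.conjPerm_commute_iff {G : Type*} [Group G] {I : Set G}
    (h : IsThreeTransposition I) (i j : I) :
    (h.conjPerm j i : G) * j = j * h.conjPerm j i ↔ (i : G) * j = j * i := by
  have hj := h.sq j j.2
  change (j : G) * i * j * j = j * (j * i * j) ↔ _
  rw [mul_assoc ((j : G) * i), hj, mul_one, mul_assoc (j : G) i j, ← mul_assoc (j : G) j, hj,
    one_mul]
  exact eq_comm

theorem matsuoMul_eq_sum {G : Type*} [Group G] {I : Set G} [Fintype I]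
    (h : IsThreeTransposition I) (α : ℂ) (v w : I →₀ ℂ) :
    matsuoMul h α v w = ∑ i, ∑ j, (v i * w j) • matsuoMulBasis h α i j := by
  unfold matsuoMul
  rw [Finsupp.sum_fintype _ _ (by simp)]
  exact Finset.sum_congr rfl fun i _ => Finsupp.sum_fintype _ _ (by simp)

theorem sum_matsuoMulBasis {G : Type*} [Group G] {I : Set G} [Fintype I]
    (h : IsThreeTransposition I) (α : ℂ) (j : I) :
    ∑ i, matsuoMulBasis h α i j =
      ((Set.ncard {i : I | (i : G) * j ≠ (j : G) * i} : ℂ) * α / 2 + 2) • xi j := by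
  have hterm : ∀ i : I, matsuoMulBasis h α i j = (if i = j then (2 : ℂ) • xi j else 0) +
      (α / 2) • ((if (i : G) * j ≠ j * i then xi i else 0) +
        (if (i : G) * j ≠ j * i then xi j else 0) -
        (if (i : G) * j ≠ j * i then xi (h.conjPerm j i) else 0)) := by
    intro i
    unfold matsuoMulBasis
    by_cases hij : i = j
    · subst hij
      simp
    by_cases hc : (i : G) * j = j * i
    · simp [hij, hc]
    · have hb : (⟨(i : G) * j * i, h.conj_mem i i.2 j j.2⟩ : I) = h.conjPerm j i :=
        Subtype.ext (h.braid I.toFinite i.2 j.2 hc)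
      simp [hij, hc, hb]
  have hperm : ∑ i : I, (if (i : G) * j ≠ j * i then xi (h.conjPerm j i) else 0) =
      ∑ i : I, (if (i : G) * j ≠ j * i then xi i else 0) := by
    rw [← Equiv.sum_comp (h.conjPerm j) fun i : I => if (i : G) * j ≠ j * i then xi i else 0]
    simp only [ne_eq, h.conjPerm_commute_iff]
  have hcard : ∑ i : I, (if (i : G) * j ≠ j * i then xi j else 0) =
      (Set.ncard {i : I | (i : G) * j ≠ (j : G) * i} : ℂ) • xi j := by
    rw [← Finset.sum_filter, Finset.sum_const, Set.ncard_eq_toFinset_card', Set.toFinset_ofPred,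
      Nat.cast_smul_eq_nsmul]
  rw [Finset.sum_congr rfl fun i _ => hterm i, Finset.sum_add_distrib, ← Finset.smul_sum,
    Finset.sum_sub_distrib, Finset.sum_add_distrib, hperm, hcard, add_sub_cancel_left,
    Finset.sum_ite_eq' Finset.univ j, if_pos (Finset.mem_univ j)]
  module

theorem sum_xi_apply {G : Type*} [Group G] {I : Set G} [Fintype I] (i : I) :
    (∑ j : I, xi j) i = 1 := by
  simp [xi, Finsupp.finsetSum_apply, Finsupp.single_apply]

theorem matsuoMul_smul_sum_xi {G : Type*} [Group G] {I : Set G} [Fintype I]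
    (h : IsThreeTransposition I) (α c : ℂ) (k : ℕ)
    (hk : ∀ i : I, Set.ncard {j : I | (j : G) * i ≠ (i : G) * j} = k) (v : I →₀ ℂ) :
    matsuoMul h α (c • ∑ i : I, xi i) v = (c * ((k : ℂ) * α / 2 + 2)) • v := by
  have hv : v = ∑ j : I, v j • xi j := by
    simp only [xi, Finsupp.smul_single, smul_eq_mul, mul_one]
    exact (Finsupp.univ_sum_single v).symm
  rw [matsuoMul_eq_sum, Finset.sum_comm]
  conv_rhs => rw [hv, Finset.smul_sum]
  refine Finset.sum_congr rfl fun j _ => ?_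
  simp only [Finsupp.smul_apply, sum_xi_apply, smul_eq_mul, mul_one]
  rw [← Finset.smul_sum, sum_matsuoMulBasis, hk]
  module

/-- If `I` is finite and a single conjugacy class, with `k` the common number of
non-commuting partners, then `(Σ_{i∈I} x^i) · x^j = (kα/2 + 2) x^j`, and if
`kα + 4 ≠ 0`, the element `ω := (4/(kα+4)) Σ_{i∈I} x^i` satisfies `ω · v = 2v`
for all `v`. -/
theorem stmt10 {G : Type*} [Group G] {I : Set G} (h : IsThreeTransposition I)
    [Fintype I] (hcc : ∀ a ∈ I, ∀ b ∈ I, IsConj a b)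
    (α β : ℂ) (hα : α ≠ 0) (hβ : β ≠ 0) (k : ℕ)
    (hk : ∀ i : I, Set.ncard {j : I | (j : G) * i ≠ (i : G) * j} = k) :
    (∀ j : I,
      matsuoMul h α (∑ i : I, xi i) (xi j) = ((k : ℂ) * α / 2 + 2) • xi j) ∧
    ((k : ℂ) * α + 4 ≠ 0 → ∀ v : I →₀ ℂ,
      matsuoMul h α ((4 / ((k : ℂ) * α + 4)) • ∑ i : I, xi i) v = (2 : ℂ) • v) := by
  refine ⟨fun j => ?_, fun hne v => ?_⟩
  · simpa using matsuoMul_smul_sum_xi h α 1 k hk (xi j)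
  · rw [matsuoMul_smul_sum_xi h α _ k hk v]
    congr 1
    field_simp
    ring
end

section
/- Let n ≥ 1 be an integer and for integers r, s define h^{(n)}_{r,s} = ((r(n+3) − s(n+2))² − 1)/(4(n+2)(n+3)) as a rational number. Then for integers r, r' with 1 ≤ r, r' ≤ n+1 and s, s' with 1 ≤ s, s' ≤ n+2, one has h^{(n)}_{r,s} = h^{(n)}_{r',s'} if and only if (r,s) = (r',s') or (r + r' = n+2 and s + s' = n+3). -/
/-- For `n ≥ 1`, `1 ≤ r, r' ≤ n+1` and `1 ≤ s, s' ≤ n+2`, the weights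
`h^{(n)}_{r,s} = ((r(n+3) − s(n+2))² − 1)/(4(n+2)(n+3))` satisfy
`h^{(n)}_{r,s} = h^{(n)}_{r',s'}` iff `(r,s) = (r',s')` or `(r+r', s+s') = (n+2, n+3)`. -/
theorem stmt16 (n : ℤ) (hn : 1 ≤ n) (r s r' s' : ℤ)
    (hr1 : 1 ≤ r) (hr2 : r ≤ n + 1) (hr1' : 1 ≤ r') (hr2' : r' ≤ n + 1)
    (hs1 : 1 ≤ s) (hs2 : s ≤ n + 2) (hs1' : 1 ≤ s') (hs2' : s' ≤ n + 2) :
    ((((r : ℚ) * (n + 3) - s * (n + 2)) ^ 2 - 1) / (4 * (n + 2) * (n + 3)) =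
      (((r' : ℚ) * (n + 3) - s' * (n + 2)) ^ 2 - 1) / (4 * (n + 2) * (n + 3))) ↔
    ((r = r' ∧ s = s') ∨ (r + r' = n + 2 ∧ s + s' = n + 3)) := by
  have hn2 : ((n : ℚ) + 2) ≠ 0 := by exact_mod_cast (by lia : n + 2 ≠ 0)
  have hn3 : ((n : ℚ) + 3) ≠ 0 := by exact_mod_cast (by lia : n + 3 ≠ 0)
  have hsq : ((((r : ℚ) * (n + 3) - s * (n + 2)) ^ 2 - 1) / (4 * (n + 2) * (n + 3)) =
      (((r' : ℚ) * (n + 3) - s' * (n + 2)) ^ 2 - 1) / (4 * (n + 2) * (n + 3))) ↔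
      (r * (n + 3) - s * (n + 2)) ^ 2 = (r' * (n + 3) - s' * (n + 2)) ^ 2 := by
    rw [div_left_inj' (mul_ne_zero (mul_ne_zero four_ne_zero hn2) hn3), sub_left_inj]
    exact_mod_cast Iff.rfl
  rw [hsq, sq_eq_sq_iff_eq_or_eq_neg]
  constructor
  · rintro (h | h)
    · have hk : r - r' = ((s - s') - (r - r')) * (n + 2) := by linear_combination h
      have hlt : (s - s') - (r - r') < 1 := by nlinarith
      have hgt : -1 < (s - s') - (r - r') := by nlinarith
      have hz : (s - s') - (r - r') = 0 := by lia
      rw [hz, zero_mul] at hk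
      lia
    · have hk : r + r' = ((s + s') - (r + r')) * (n + 2) := by linear_combination h
      have hlt : (s + s') - (r + r') < 2 := by nlinarith
      have hgt : 0 < (s + s') - (r + r') := by nlinarith
      have hz : (s + s') - (r + r') = 1 := by lia
      rw [hz, one_mul] at hk
      lia
  · rintro (⟨rfl, rfl⟩ | ⟨hr, hs⟩)
    · exact Or.inl rfl
    · exact Or.inr (by linear_combination (n + 3) * hr - (n + 2) * hs)
end

section
/- Let n ≥ 1, let G be the symmetric group S_{n+1}, and let I be its set of transpositions, so that (G,I) is a 3-transposition group in which two distinct transpositions are non-commuting exactly when their supports share one point. Then the symmetric bilinear form on the Matsuo algebra B_{1/2,1/2}(S_{n+1}) (given on the basis {x^i : i ∈ I} by (x^i|x^i) = 1/4, (x^i|x^j) = 1/32 if i ∼ j, and (x^i|x^j) = 0 for distinct commuting i, j) is non-degenerate. -/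
open scoped Classical

variable {G : Type*} [Group G] {I : Set G}

/-- The supports of two transpositions share two, no or one points according to whether the
transpositions are equal, distinct and commuting, or non-commuting. -/
theorem card_support_inter_of_isSwap {α : Type*} [Fintype α] [DecidableEq α] {σ τ : Equiv.Perm α}
    (hσ : σ.IsSwap) (hτ : τ.IsSwap) :
    (σ.support ∩ τ.support).card = if σ = τ then 2 else if σ * τ = τ * σ then 0 else 1 := by
  have key : ∀ a b d : α, a ≠ b → a ≠ d → b ≠ d →
      Equiv.swap a b * Equiv.swap a d ≠ Equiv.swap a d * Equiv.swap a b := by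
    intro a b d hab had hbd h
    have := congrArg (fun f : Equiv.Perm α => f a) h
    simp [Equiv.swap_apply_of_ne_of_ne, hab.symm, had.symm, hbd, hbd.symm] at this
  have hσ2 := Equiv.Perm.card_support_eq_two.2 hσ
  obtain ⟨a, b, hab, rfl⟩ := hσ
  obtain ⟨c, d, hcd, rfl⟩ := hτ
  split_ifs with h1 h2
  · rw [← h1, Finset.inter_self, hσ2]
  · rw [Finset.card_eq_zero, Finset.eq_empty_iff_forall_notMem]
    intro x hx
    rw [Finset.mem_inter, Equiv.Perm.support_swap hab, Equiv.Perm.support_swap hcd] at hx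
    simp only [Finset.mem_insert, Finset.mem_singleton] at hx
    obtain ⟨rfl | rfl, rfl | rfl⟩ := hx
    · exact key x b d hab hcd (fun e => h1 (by rw [e])) h2
    · rw [Equiv.swap_comm c x] at h1 h2
      exact key x b c hab hcd.symm (fun e => h1 (by rw [e])) h2
    · rw [Equiv.swap_comm a x] at h1 h2
      exact key x a d hab.symm hcd (fun e => h1 (by rw [e])) h2
    · rw [Equiv.swap_comm a x, Equiv.swap_comm c x] at h1 h2
      exact key x a c hab.symm hcd.symm (fun e => h1 (by rw [e])) h2
  · have hpos : 0 < ((Equiv.swap a b).support ∩ (Equiv.swap c d).support).card := by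
      rw [Finset.card_pos, Finset.nonempty_iff_ne_empty]
      intro h
      exact h2 (Equiv.Perm.disjoint_iff_disjoint_support.2
        (Finset.disjoint_iff_inter_eq_empty.2 h)).commute.eq
    have hlt : ((Equiv.swap a b).support ∩ (Equiv.swap c d).support).card < 2 := by
      by_contra! h
      have e1 := Finset.eq_of_subset_of_card_le
        (Finset.inter_subset_left (s₁ := (Equiv.swap a b).support)
          (s₂ := (Equiv.swap c d).support)) (by omega)
      have hsub := Finset.inter_eq_left.1 e1
      rw [Equiv.Perm.support_swap hab, Equiv.Perm.support_swap hcd] at hsub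
      have ha := hsub (Finset.mem_insert_self a {b})
      have hb := hsub (Finset.mem_insert_of_mem (Finset.mem_singleton_self b))
      simp only [Finset.mem_insert, Finset.mem_singleton] at ha hb
      obtain rfl | rfl := ha <;> obtain rfl | rfl := hb
      · exact hab rfl
      · exact h1 rfl
      · exact h1 (Equiv.swap_comm _ _)
      · exact hab rfl
    omega

/-- The Gram matrix of the form of `B_{1/2,1/2}` is a positive multiple of the identity plus a
positive multiple of the Gram matrix of the indicator vectors of the supports. -/
theorem matsuoFormBasis_isSwap {α : Type*} [Fintype α] [DecidableEq α]
    (i j : {σ : Equiv.Perm α | σ.IsSwap}) :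
    matsuoFormBasis (1 / 2 : ℂ) (1 / 2 : ℂ) i j = 3 / 16 * (if i = j then 1 else 0) +
      1 / 32 * ∑ p, (if p ∈ (i : Equiv.Perm α).support then 1 else 0) *
        (if p ∈ (j : Equiv.Perm α).support then 1 else 0) := by
  have hs : (∑ p, (if p ∈ (i : Equiv.Perm α).support then (1 : ℂ) else 0) *
      (if p ∈ (j : Equiv.Perm α).support then 1 else 0)) =
      (((i : Equiv.Perm α).support ∩ (j : Equiv.Perm α).support).card : ℂ) := by
    simp only [← ite_and, mul_ite, mul_one, mul_zero, Finset.sum_boole]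
    congr 2
    ext p
    simp [and_comm]
  rw [hs, card_support_inter_of_isSwap i.2 j.2]
  unfold matsuoFormBasis
  simp only [Subtype.ext_iff]
  split_ifs <;> norm_num

/-- A Hermitian matrix of the form `a • 1 + b • Bᵀ B` with `a > 0`, `b ≥ 0` and `B` real has
trivial kernel. -/
theorem eq_zero_of_sum_identity_add_gram_eq_zero {ι κ : Type*} [Fintype ι] [Fintype κ]
    {a b : ℝ} (ha : 0 < a) (hb : 0 ≤ b) (B : κ → ι → ℝ) (v : ι → ℂ)
    (h : ∀ j, ∑ i, v i * (a * (if i = j then 1 else 0) + b * ∑ p, (B p i : ℂ) * B p j) = 0) :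
    v = 0 := by
  have e : ((a * ∑ i, Complex.normSq (v i) +
      b * ∑ p, Complex.normSq (∑ i, v i * B p i) : ℝ) : ℂ) = 0 := by
    have h0 : ∑ j, (starRingEnd ℂ) (v j) *
        ∑ i, v i * (a * (if i = j then 1 else 0) + b * ∑ p, (B p i : ℂ) * B p j) = 0 :=
      Finset.sum_eq_zero fun j _ => by rw [h j, mul_zero]
    rw [← h0]
    push_cast
    simp only [Complex.normSq_eq_conj_mul_self, map_sum, map_mul, Complex.conj_ofReal]
    simp only [mul_add, Finset.sum_add_distrib, mul_ite, mul_one, mul_zero,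
      Finset.sum_ite_eq', Finset.mem_univ, if_true, Finset.mul_sum, Finset.sum_mul]
    congr 1
    · exact Finset.sum_congr rfl fun _ _ => by ring
    · rw [Finset.sum_comm]
      conv_rhs => rw [Finset.sum_comm]
      refine Finset.sum_congr rfl fun y _ => ?_
      rw [Finset.sum_comm]
      exact Finset.sum_congr rfl fun _ _ => Finset.sum_congr rfl fun _ _ => by ring
  have e' := Complex.ofReal_eq_zero.1 e
  have h1 : 0 ≤ ∑ p, Complex.normSq (∑ i, v i * B p i) :=
    Finset.sum_nonneg fun _ _ => Complex.normSq_nonneg _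
  have h2 : 0 ≤ ∑ i, Complex.normSq (v i) :=
    Finset.sum_nonneg fun _ _ => Complex.normSq_nonneg _
  have h3 : ∑ i, Complex.normSq (v i) = 0 := by nlinarith [mul_nonneg hb h1]
  funext i
  exact Complex.normSq_eq_zero.1
    ((Finset.sum_eq_zero_iff_of_nonneg fun _ _ => Complex.normSq_nonneg _).1 h3 i
      (Finset.mem_univ i))

/-- The bilinear form on the Matsuo algebra `B_{1/2,1/2}(S_{n+1})` associated with the
symmetric group `S_{n+1}` with its set of transpositions is non-degenerate. -/
theorem stmt17 (n : ℕ) (hn : 1 ≤ n)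
    (h : IsThreeTransposition {σ : Equiv.Perm (Fin (n + 1)) | σ.IsSwap}) :
    ∀ v : {σ : Equiv.Perm (Fin (n + 1)) | σ.IsSwap} →₀ ℂ,
      (∀ w, matsuoForm (1 / 2 : ℂ) (1 / 2 : ℂ) v w = 0) → v = 0 := by
  intro v hv
  apply DFunLike.coe_injective
  refine eq_zero_of_sum_identity_add_gram_eq_zero (a := 3 / 16) (b := 1 / 32) (by norm_num)
    (by norm_num) (fun (p : Fin (n + 1))
      (i : {σ : Equiv.Perm (Fin (n + 1)) | σ.IsSwap}) =>
      if p ∈ (i : Equiv.Perm (Fin (n + 1))).support then 1 else 0) v fun j => ?_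
  refine Eq.trans ?_ (hv (Finsupp.single j 1))
  rw [matsuoForm, Finsupp.sum_fintype _ _ (by simp)]
  refine Finset.sum_congr rfl fun i _ => ?_
  rw [Finsupp.sum_single_index (by simp), matsuoFormBasis_isSwap, mul_one]
  push_cast
  congr! <;> split_ifs <;> simp
end
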